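/- arXiv:2001.00936 — 2 statements merged into one kernel-verified Lean document; each statement's English description precedes it below -/
import Mathlib

section
/- Existence Property: Suppose L contains at least one constant symbol. Then for any set Γ of L-sentences containing no occurrence of ∨ and no occurrence of ∃, and any L-formula φ: Γ ⊨ ∃vφ only if Γ ⊨ φ(t) for some closed L-term t. -/
universe u v

namespace BQL

structure Signature : Type 1 where
  Const : Type
  Func : Type
  arityF : Func → ℕ
  Rel : Type
  arityR : Rel → ℕ

inductive Term (L : Signature) : Type
  | var : ℕ → Term L
  | const : L.Const → Term L
  | func : (f : L.Func) → (Fin (L.arityF f) → Term L) → Term L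

inductive Formula (L : Signature) : Type
  | top : Formula L
  | bot : Formula L
  | rel : (R : L.Rel) → (Fin (L.arityR R) → Term L) → Formula L
  | and : Formula L → Formula L → Formula L
  | or : Formula L → Formula L → Formula L
  | imp : Formula L → Formula L → Formula L
  | all : Formula L → Formula L
  | ex : Formula L → Formula L

variable {L : Signature}

namespace Term

/-- Shift all (free) variables of a term up by one. -/
def shiftUp : Term L → Term L
  | var n => var (n + 1)
  | const c => const c
  | func f ts => func f fun i => (ts i).shiftUp

/-- Apply a simultaneous substitution to a term. -/
def applySub (σ : ℕ → Term L) : Term L → Term L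
  | var n => σ n
  | const c => const c
  | func f ts => func f fun i => (ts i).applySub σ

/-- All variables of the term are `< k`. -/
def ClosedAt : Term L → ℕ → Prop
  | var n, k => n < k
  | const _, _ => True
  | func _ ts, k => ∀ i, (ts i).ClosedAt k

/-- A closed term. -/
def Closed (t : Term L) : Prop := t.ClosedAt 0

/-- The constant `c` occurs in the term. -/
def OccC (c : L.Const) : Term L → Prop
  | var _ => False
  | const d => d = c
  | func _ ts => ∃ i, (ts i).OccC c

end Term

/-- Lift a substitution under a binder. -/
def liftSub (σ : ℕ → Term L) : ℕ → Term L
  | 0 => .var 0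
  | n + 1 => (σ n).shiftUp

namespace Formula

/-- Apply a simultaneous substitution to a formula. -/
def applySub (σ : ℕ → Term L) : Formula L → Formula L
  | top => top
  | bot => bot
  | rel R ts => rel R fun i => (ts i).applySub σ
  | and φ ψ => and (φ.applySub σ) (ψ.applySub σ)
  | or φ ψ => or (φ.applySub σ) (ψ.applySub σ)
  | imp φ ψ => imp (φ.applySub σ) (ψ.applySub σ)
  | all φ => all (φ.applySub (liftSub σ))
  | ex φ => ex (φ.applySub (liftSub σ))

/-- All free variables of the formula are `< k`. -/
def ClosedAt : Formula L → ℕ → Prop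
  | top, _ => True
  | bot, _ => True
  | rel _ ts, k => ∀ i, (ts i).ClosedAt k
  | and φ ψ, k => φ.ClosedAt k ∧ ψ.ClosedAt k
  | or φ ψ, k => φ.ClosedAt k ∧ ψ.ClosedAt k
  | imp φ ψ, k => φ.ClosedAt k ∧ ψ.ClosedAt k
  | all φ, k => φ.ClosedAt (k + 1)
  | ex φ, k => φ.ClosedAt (k + 1)

/-- A sentence: a formula with no free variables. -/
def Sentence (φ : Formula L) : Prop := φ.ClosedAt 0

/-- The constant `c` occurs in the formula. -/
def OccC (c : L.Const) : Formula L → Prop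
  | top => False
  | bot => False
  | rel _ ts => ∃ i, (ts i).OccC c
  | and φ ψ => φ.OccC c ∨ ψ.OccC c
  | or φ ψ => φ.OccC c ∨ ψ.OccC c
  | imp φ ψ => φ.OccC c ∨ ψ.OccC c
  | all φ => φ.OccC c
  | ex φ => φ.OccC c

/-- The formula contains no occurrence of `∨` and no occurrence of `∃`. -/
def NoOrEx : Formula L → Prop
  | top => True
  | bot => True
  | rel _ _ => True
  | and φ ψ => φ.NoOrEx ∧ ψ.NoOrEx
  | or _ _ => False
  | imp φ ψ => φ.NoOrEx ∧ ψ.NoOrEx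
  | all φ => φ.NoOrEx
  | ex _ => False

end Formula

/-- Substitute the term `t` for the variable `v₀` (lowering the other variables). -/
def subst0 (φ : Formula L) (t : Term L) : Formula L :=
  φ.applySub fun n => match n with | 0 => t | n + 1 => .var n

/-- `□ⁿφ`, where `□φ` abbreviates `⊤ → φ`. -/
def boxN : ℕ → Formula L → Formula L
  | 0, φ => φ
  | n + 1, φ => .imp .top (boxN n φ)

/-- The conjunction of a finite list of formulas (`⋀∅ = ⊤`). -/
def conjL : List (Formula L) → Formula L
  | [] => .top
  | [φ] => φ
  | φ :: ψ :: l => .and φ (conjL (ψ :: l))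

/-- The language `L⁺`, obtained from `L` by adding countably many fresh constants `aᵢ`. -/
def Signature.plus (L : Signature) : Signature where
  Const := L.Const ⊕ ℕ
  Func := L.Func
  arityF := L.arityF
  Rel := L.Rel
  arityR := L.arityR

/-- The fresh constant `aᵢ` of `L⁺`. -/
def aconst (L : Signature) (i : ℕ) : Term L.plus := .const (Sum.inr i)

/-- Embedding of `L`-terms into `L⁺`-terms. -/
def Term.emb : Term L → Term L.plus
  | .var n => .var n
  | .const c => .const (Sum.inl c)
  | .func f ts => .func f fun i => (ts i).emb

/-- Embedding of `L`-formulas into `L⁺`-formulas. -/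
def Formula.emb : Formula L → Formula L.plus
  | .top => .top
  | .bot => .bot
  | .rel R ts => .rel R fun i => (ts i).emb
  | .and φ ψ => .and φ.emb ψ.emb
  | .or φ ψ => .or φ.emb ψ.emb
  | .imp φ ψ => .imp φ.emb ψ.emb
  | .all φ => .all φ.emb
  | .ex φ => .ex φ.emb

/-- The fresh constant `aᵢ` occurs in no member of `Γ`. -/
def FreshIn (i : ℕ) (Γ : Set (Formula L.plus)) : Prop :=
  ∀ ψ ∈ Γ, ¬ ψ.OccC (Sum.inr i)

/-- A Kripke `L`-model (the frame conditions are packaged in `KModel.Proper`). -/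
structure KModel (L : Signature) : Type (u + 1) where
  W : Type u
  acc : W → W → Prop
  D : Type u
  interpC : L.Const → D
  interpF : (f : L.Func) → (Fin (L.arityF f) → D) → D
  interpR : (R : L.Rel) → W → Set (Fin (L.arityR R) → D)

/-- The conditions on an `L`-model: nonempty set of worlds, transitive accessibility
relation, nonempty domain, and the persistence constraint. -/
def KModel.Proper (M : KModel.{u} L) : Prop :=
  Nonempty M.W ∧ Nonempty M.D ∧ Transitive M.acc ∧
    ∀ (R : L.Rel) (w u' : M.W), M.acc w u' → M.interpR R w ⊆ M.interpR R u'

/-- Prepend a value to a valuation. -/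
def vcons {α : Sort*} (d : α) (ρ : ℕ → α) : ℕ → α
  | 0 => d
  | n + 1 => ρ n

/-- Denotation of a term. -/
def Term.eval (M : KModel.{u} L) (ρ : ℕ → M.D) : Term L → M.D
  | .var n => ρ n
  | .const c => M.interpC c
  | .func f ts => M.interpF f fun i => (ts i).eval M ρ

/-- The satisfaction relation `w ⊩ φ(ā)`. -/
def Sat (M : KModel.{u} L) : M.W → (ℕ → M.D) → Formula L → Prop
  | _, _, .top => True
  | _, _, .bot => False
  | w, ρ, .rel R ts => (fun i => (ts i).eval M ρ) ∈ M.interpR R w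
  | w, ρ, .and φ ψ => Sat M w ρ φ ∧ Sat M w ρ ψ
  | w, ρ, .or φ ψ => Sat M w ρ φ ∨ Sat M w ρ ψ
  | w, ρ, .imp φ ψ => ∀ u', M.acc w u' → Sat M u' ρ φ → Sat M u' ρ ψ
  | w, ρ, .all φ => ∀ d, Sat M w (vcons d ρ) φ
  | w, ρ, .ex φ => ∃ d, Sat M w (vcons d ρ) φ

/-- Satisfaction of a sentence (under every valuation). -/
def SatS (M : KModel.{u} L) (w : M.W) (φ : Formula L) : Prop := ∀ ρ, Sat M w ρ φ

/-- `Γ ⊨ φ`: truth is preserved at every reflexive world of every `L`-model. -/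
def Models (Γ : Set (Formula L)) (φ : Formula L) : Prop :=
  ∀ M : KModel.{u} L, M.Proper → ∀ w : M.W, M.acc w w →
    (∀ ψ ∈ Γ, SatS M w ψ) → SatS M w φ

/-- `Γ : Δ ⊨ φ`: for every `L`-model, every reflexive world `w` and every world `u ≻ w`:
if `w ⊩ Γ` and `u ⊩ Δ` then `u ⊩ φ`. -/
def ModelsCtx (Γ Δ : Set (Formula L)) (φ : Formula L) : Prop :=
  ∀ M : KModel.{u} L, M.Proper → ∀ w u' : M.W, M.acc w w → M.acc w u' →
    (∀ ψ ∈ Γ, SatS M w ψ) → (∀ ψ ∈ Δ, SatS M u' ψ) → SatS M u' φ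

end BQL

namespace BQL

section Semantics

variable {L : Signature} (M : KModel.{u} L)

theorem comp_vcons {α β : Type*} (f : α → β) (d : α) (ρ : ℕ → α) :
    f ∘ vcons d ρ = vcons (f d) (f ∘ ρ) := by
  funext n
  cases n <;> rfl

theorem Term.eval_shiftUp (d : M.D) (ρ : ℕ → M.D) (t : Term L) :
    t.shiftUp.eval M (vcons d ρ) = t.eval M ρ := by
  induction t with
  | var n => rfl
  | const c => rfl
  | func f ts ih => simp only [Term.shiftUp, Term.eval, ih]

theorem Term.eval_applySub (σ : ℕ → Term L) (ρ : ℕ → M.D) (t : Term L) :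
    (t.applySub σ).eval M ρ = t.eval M fun n => (σ n).eval M ρ := by
  induction t with
  | var n => rfl
  | const c => rfl
  | func f ts ih => simp only [Term.applySub, Term.eval, ih]

theorem eval_liftSub (σ : ℕ → Term L) (d : M.D) (ρ : ℕ → M.D) :
    (fun n => (liftSub σ n).eval M (vcons d ρ)) = vcons d fun n => (σ n).eval M ρ := by
  funext n
  cases n with
  | zero => rfl
  | succ n => exact Term.eval_shiftUp M d ρ (σ n)

theorem sat_applySub (φ : Formula L) (w : M.W) (σ : ℕ → Term L) (ρ : ℕ → M.D) :
    Sat M w ρ (φ.applySub σ) ↔ Sat M w (fun n => (σ n).eval M ρ) φ := by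
  induction φ generalizing w σ ρ <;>
    simp_all [Formula.applySub, Sat, Term.eval_applySub, eval_liftSub]

theorem Term.eval_congr {k : ℕ} {ρ ρ' : ℕ → M.D} (hρ : ∀ n < k, ρ n = ρ' n) (t : Term L)
    (ht : t.ClosedAt k) : t.eval M ρ = t.eval M ρ' := by
  induction t with
  | var n => exact hρ n ht
  | const c => rfl
  | func f ts ih => simp only [Term.eval, fun i => ih i (ht i)]

theorem sat_congr (φ : Formula L) {k : ℕ} {ρ ρ' : ℕ → M.D} (hρ : ∀ n < k, ρ n = ρ' n)
    (hφ : φ.ClosedAt k) (w : M.W) : Sat M w ρ φ ↔ Sat M w ρ' φ := by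
  induction φ generalizing k ρ ρ' w with
  | top => rfl
  | bot => rfl
  | rel R ts => simp only [Sat, fun i => Term.eval_congr M hρ (ts i) (hφ i)]
  | and φ ψ ihφ ihψ => exact and_congr (ihφ hρ hφ.1 w) (ihψ hρ hφ.2 w)
  | or φ ψ ihφ ihψ => exact or_congr (ihφ hρ hφ.1 w) (ihψ hρ hφ.2 w)
  | imp φ ψ ihφ ihψ =>
    exact forall₂_congr fun v _ => imp_congr (ihφ hρ hφ.1 v) (ihψ hρ hφ.2 v)
  | all φ ih =>
    refine forall_congr' fun d => ih (fun n hn => ?_) hφ w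
    cases n with
    | zero => rfl
    | succ n => exact hρ n (Nat.lt_of_succ_lt_succ hn)
  | ex φ ih =>
    refine exists_congr fun d => ih (fun n hn => ?_) hφ w
    cases n with
    | zero => rfl
    | succ n => exact hρ n (Nat.lt_of_succ_lt_succ hn)

theorem sat_subst0 {φ : Formula L} (hφ : φ.ClosedAt 1) (t : Term L) (w : M.W)
    (ρ ρ' : ℕ → M.D) :
    Sat M w ρ (subst0 φ t) ↔ Sat M w (vcons (t.eval M ρ) ρ') φ := by
  rw [subst0, sat_applySub]
  refine sat_congr M φ (fun n hn => ?_) hφ w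
  obtain rfl : n = 0 := by omega
  rfl

variable {M}

/-- Persistence extends from atomic formulas to all formulas. -/
theorem Sat.mono (hM : M.Proper) {φ : Formula L} {w v : M.W} (hwv : M.acc w v)
    {ρ : ℕ → M.D} (h : Sat M w ρ φ) : Sat M v ρ φ := by
  induction φ generalizing ρ with
  | top => trivial
  | bot => exact h
  | rel R ts => exact hM.2.2.2 R w v hwv h
  | and φ ψ ihφ ihψ => exact h.imp ihφ ihψ
  | or φ ψ ihφ ihψ => exact h.imp ihφ ihψ
  | imp φ ψ _ _ => exact fun x hx => h x (hM.2.2.1 hwv hx)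
  | all φ ih => exact fun d => ih (h d)
  | ex φ ih => exact h.imp fun d => ih

end Semantics

section Glue

variable {L : Signature} {S : Type u} (M : S → KModel.{u} L) (w : ∀ s, (M s).W)

/-- Accessibility on the disjoint union of the frames of `M s` together with a reflexive root
`none` that sees everything seen by some `w s`. -/
inductive GlueAcc : Option (Σ s, (M s).W) → Option (Σ s, (M s).W) → Prop
  | root : GlueAcc none none
  | up {s : S} {v : (M s).W} : (M s).acc (w s) v → GlueAcc none (some ⟨s, v⟩)
  | step {s : S} {v v' : (M s).W} :
      (M s).acc v v' → GlueAcc (some ⟨s, v⟩) (some ⟨s, v'⟩)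

variable (D : Type u) (iC : L.Const → D)
  (iF : (f : L.Func) → (Fin (L.arityF f) → D) → D) (π : ∀ s, D → (M s).D)

/-- The models `M s` glued above a common root, over a common domain `D` which projects to
each of their domains. -/
def glue : KModel.{u} L where
  W := Option (Σ s, (M s).W)
  acc := GlueAcc M w
  D := D
  interpC := iC
  interpF := iF
  interpR R x := match x with
    | none => {ds | ∀ s, π s ∘ ds ∈ (M s).interpR R (w s)}
    | some ⟨s, v⟩ => {ds | π s ∘ ds ∈ (M s).interpR R v}

variable {M w D iC iF π}

theorem glue_proper [Nonempty D] (hM : ∀ s, (M s).Proper) :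
    (glue M w D iC iF π).Proper := by
  refine ⟨⟨none⟩, ‹Nonempty D›, ?_, ?_⟩
  · intro x y z hxy hyz
    cases hxy with
    | root => exact hyz
    | up h =>
      cases hyz with
      | step h' => exact .up ((hM _).2.2.1 h h')
    | step h =>
      cases hyz with
      | step h' => exact .step ((hM _).2.2.1 h h')
  · intro R x y hxy ds hds
    cases hxy with
    | root => exact hds
    | up h => exact (hM _).2.2.2 R _ _ h (hds _)
    | step h => exact (hM _).2.2.2 R _ _ h hds

theorem eval_glue (hC : ∀ s c, π s (iC c) = (M s).interpC c)
    (hF : ∀ s f ds, π s (iF f ds) = (M s).interpF f (π s ∘ ds)) (s : S) (ρ : ℕ → D)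
    (t : Term L) : π s (t.eval (glue M w D iC iF π) ρ) = t.eval (M s) (π s ∘ ρ) := by
  induction t with
  | var n => rfl
  | const c => exact hC s c
  | func f ts ih =>
    refine (hF s f _).trans (congrArg _ (funext fun i => ?_))
    exact ih i

theorem sat_glue (hC : ∀ s c, π s (iC c) = (M s).interpC c)
    (hF : ∀ s f ds, π s (iF f ds) = (M s).interpF f (π s ∘ ds))
    (hπ : ∀ s, Function.Surjective (π s)) (φ : Formula L) {s : S} (v : (M s).W)
    (ρ : ℕ → D) :
    Sat (glue M w D iC iF π) (some ⟨s, v⟩) ρ φ ↔ Sat (M s) v (π s ∘ ρ) φ := by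
  induction φ generalizing v ρ with
  | top => rfl
  | bot => rfl
  | rel R ts =>
    have h : (fun i => (ts i).eval (M s) (π s ∘ ρ)) =
        π s ∘ fun i => (ts i).eval (glue M w D iC iF π) ρ :=
      funext fun i => (eval_glue hC hF s ρ (ts i)).symm
    change _ ↔ (fun i => (ts i).eval (M s) (π s ∘ ρ)) ∈ (M s).interpR R v
    rw [h]
    rfl
  | and φ ψ ihφ ihψ => exact and_congr (ihφ v ρ) (ihψ v ρ)
  | or φ ψ ihφ ihψ => exact or_congr (ihφ v ρ) (ihψ v ρ)
  | imp φ ψ ihφ ihψ =>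
    constructor
    · intro h v' hv hφ
      exact (ihψ v' ρ).1 (h _ (GlueAcc.step hv) ((ihφ v' ρ).2 hφ))
    · intro h x hx hφ
      cases hx with
      | step hv => exact (ihψ _ ρ).2 (h _ hv ((ihφ _ ρ).1 hφ))
  | all φ ih =>
    refine Iff.trans (forall_congr' fun d => ih v (vcons d ρ)) ?_
    change (∀ d : D, Sat (M s) v (π s ∘ vcons d ρ) φ) ↔ _
    simp only [comp_vcons]
    exact (hπ s).forall (p := fun e => Sat (M s) v (vcons e (π s ∘ ρ)) φ) |>.symm
  | ex φ ih =>
    refine Iff.trans (exists_congr fun d => ih v (vcons d ρ)) ?_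
    change (∃ d : D, Sat (M s) v (π s ∘ vcons d ρ) φ) ↔ _
    simp only [comp_vcons]
    exact (hπ s).exists (p := fun e => Sat (M s) v (vcons e (π s ∘ ρ)) φ) |>.symm

/-- A formula without `∨` and `∃` that holds at all worlds `w s` holds at the root. -/
theorem sat_glue_root [Nonempty S] [Nonempty D] (hM : ∀ s, (M s).Proper)
    (hw : ∀ s, (M s).acc (w s) (w s)) {φ : Formula L} (hφ : φ.NoOrEx) {ρ : ℕ → D}
    (h : ∀ s, Sat (glue M w D iC iF π) (some ⟨s, w s⟩) ρ φ) :
    Sat (glue M w D iC iF π) none ρ φ := by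
  induction φ generalizing ρ with
  | top => trivial
  | bot => exact h (Classical.arbitrary S)
  | rel R ts => exact h
  | and φ ψ ihφ ihψ => exact ⟨ihφ hφ.1 fun s => (h s).1, ihψ hφ.2 fun s => (h s).2⟩
  | or φ ψ => exact hφ.elim
  | imp φ ψ ihφ ihψ =>
    intro x hx hsat
    cases hx with
    | root =>
      exact ihψ hφ.2 fun s =>
        h s _ (GlueAcc.step (hw s)) (hsat.mono (glue_proper hM) (GlueAcc.up (hw s)))
    | up hv => exact h _ _ (GlueAcc.step hv) hsat
  | all φ ih => exact fun d => ih hφ fun s => h s d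
  | ex φ => exact hφ.elim

end Glue

/-- Closed terms of `L` expanded by a set `X` of new constants. -/
inductive GenTerm (L : Signature) (X : Type u) : Type u
  | gen : X → GenTerm L X
  | const : L.Const → GenTerm L X
  | func : (f : L.Func) → (Fin (L.arityF f) → GenTerm L X) → GenTerm L X

namespace GenTerm

variable {L : Signature} {X : Type u}

/-- Replace all new constants by the constant `c` of `L`. -/
def collapse (c : L.Const) : GenTerm L X → Term L
  | gen _ => .const c
  | const d => .const d
  | func f ts => .func f fun i => (ts i).collapse c

/-- Denotation of a term, given an interpretation of the new constants. -/
def eval (M : KModel.{u} L) (g : X → M.D) : GenTerm L X → M.D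
  | gen x => g x
  | const c => M.interpC c
  | func f ts => M.interpF f fun i => (ts i).eval M g

/-- The new constants occurring in a term. -/
def support : GenTerm L X → Set X
  | gen x => {x}
  | const _ => ∅
  | func _ ts => ⋃ i, (ts i).support

theorem collapse_closed (c : L.Const) (t : GenTerm L X) : (t.collapse c).Closed := by
  induction t with
  | gen x => trivial
  | const d => trivial
  | func f ts ih => exact ih

theorem support_finite (t : GenTerm L X) : t.support.Finite := by
  induction t with
  | gen x => exact Set.finite_singleton x
  | const c => exact Set.finite_empty
  | func f ts ih => exact Set.finite_iUnion ih

theorem eval_collapse (M : KModel.{u} L) {g : X → M.D} {c : L.Const} (ρ : ℕ → M.D)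
    (t : GenTerm L X) (h : ∀ x ∈ t.support, g x = M.interpC c) :
    (t.collapse c).eval M ρ = t.eval M g := by
  induction t with
  | gen x => exact (h x rfl).symm
  | const d => rfl
  | func f ts ih =>
    exact congrArg _ (funext fun i => ih i fun x hx => h x (Set.mem_iUnion_of_mem i hx))

end GenTerm

/-- The second projection `ℕ × Y → Y` has, over each point, a point outside a given finite set. -/
theorem exists_mk_notMem_finite {Y : Type u} {A : Set (ℕ × Y)} (hA : A.Finite) (y : Y) :
    ∃ n, (n, y) ∉ A := by
  have hinj : Function.Injective fun n : ℕ => (n, y) := fun _ _ h => congrArg Prod.fst h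
  obtain ⟨_, ⟨n, rfl⟩, hn⟩ := (Set.infinite_range_of_injective hinj).exists_notMem_finite hA
  exact ⟨n, hn⟩

/-- **Existence Property** (Theorem 20): suppose `L` contains at least one constant
symbol; then for `Γ ⊆ L \ {∨, ∃}`: `Γ ⊨ ∃v φ` only if `Γ ⊨ φ(t)` for some closed
`L`-term `t`. -/
theorem existence_property {L : Signature} (hc : Nonempty L.Const)
    (Γ : Set (Formula L)) (φ : Formula L)
    (hΓ : ∀ χ ∈ Γ, Formula.Sentence χ ∧ Formula.NoOrEx χ) (hφ : φ.ClosedAt 1)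
    (h : Models.{u} Γ (.ex φ)) :
    ∃ t : Term L, t.Closed ∧ Models.{u} Γ (subst0 φ t) := by
  classical
  obtain ⟨c⟩ := hc
  by_contra hcon
  have hcounter : ∀ t : {t : Term L // t.Closed}, ∃ (M : KModel.{u} L) (w : M.W)
      (ρ : ℕ → M.D), M.Proper ∧ M.acc w w ∧ (∀ ψ ∈ Γ, SatS M w ψ) ∧
        ¬ Sat M w ρ (subst0 φ t) := by
    intro t
    by_contra hno
    refine hcon ⟨t, t.2, fun M hM w hw hsat ρ => ?_⟩
    by_contra hn
    exact hno ⟨M, w, ρ, hM, hw, hsat, hn⟩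
  choose M w ρ hM hw hsat hn using hcounter
  let X := ℕ × ∀ t, (M t).D
  let T := GenTerm L X
  let τ : T → {t : Term L // t.Closed} := fun s => ⟨s.collapse c, s.collapse_closed c⟩
  -- New constants occurring in `s` denote `c`, so that `s` denotes what `τ s` does.
  let g : ∀ s : T, X → (M (τ s)).D := fun s x =>
    if x ∈ s.support then (M (τ s)).interpC c else x.2 (τ s)
  let π : ∀ s : T, T → (M (τ s)).D := fun s => GenTerm.eval (M (τ s)) (g s)
  have hπ : ∀ s, Function.Surjective (π s) := by
    intro s d
    have hD : ∀ t, Nonempty (M t).D := fun t => (hM t).2.1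
    let y : ∀ t, (M t).D := Function.update (fun t => (hD t).some) (τ s) d
    have hy : y (τ s) = d := by simp [y]
    obtain ⟨n, hnot⟩ := exists_mk_notMem_finite s.support_finite y
    exact ⟨.gen (n, y), (if_neg hnot).trans hy⟩
  have : Nonempty T := ⟨.const c⟩
  let N := glue (fun s => M (τ s)) (fun s => w (τ s)) T GenTerm.const GenTerm.func π
  have hN : N.Proper := glue_proper fun s => hM (τ s)
  have hsatN : ∀ (χ : Formula L) (s : T) (ρ : ℕ → T),
      Sat N (some ⟨s, w (τ s)⟩) ρ χ ↔ Sat (M (τ s)) (w (τ s)) (π s ∘ ρ) χ :=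
    fun χ s ρ => sat_glue (iC := GenTerm.const) (iF := GenTerm.func) (fun _ _ => rfl)
      (fun _ _ _ => rfl) hπ χ (w (τ s)) ρ
  have hroot : ∀ χ ∈ Γ, SatS N none χ := fun χ hχ ρ =>
    sat_glue_root (fun s => hM (τ s)) (fun s => hw (τ s)) (hΓ χ hχ).2 fun s =>
      (hsatN χ s ρ).2 (hsat (τ s) χ hχ _)
  let ρT : ℕ → T := fun _ => GenTerm.const c
  obtain ⟨(s : T), hs⟩ := h N hN none GlueAcc.root hroot ρT
  have hs' : Sat (M (τ s)) (w (τ s)) (vcons (π s s) (π s ∘ ρT)) φ :=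
    comp_vcons (π s) s ρT ▸ (hsatN φ s _).1 (hs.mono hN (GlueAcc.up (hw (τ s))))
  refine hn (τ s) ((sat_subst0 (M (τ s)) hφ _ _ _ (π s ∘ ρT)).2 ?_)
  have heval : (s.collapse c).eval (M (τ s)) (ρ (τ s)) = π s s :=
    GenTerm.eval_collapse (M (τ s)) (ρ (τ s)) s fun x hx => if_pos hx
  rw [heval]
  exact hs'

end BQL
end

section
/- BQL_CD^r and BQL_CD have the same theorems: For every L⁺-sentence φ, ⊢_{[-1]} φ (φ is provable from no assumptions in NBQL_CD) if and only if ⊢ φ (φ is provable from no assumptions in NBQL_CD^r). -/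
universe u v

namespace BQL

/-- `Prf L Γ Δ φ` formalizes `Γ : Δ ⊢ φ`: there is a proof of `φ` in the natural
deduction system `NBQL_CD^r` (over `L⁺`-sentences) whose open assumptions all belong
to `Γ ∪ Δ` and in which every open assumption occurring *unsafely* (i.e. in the right
main subproof of an application of `→`-Elim) belongs to `Γ`.  Assumptions may be
discharged only at safe occurrences, so discharge always happens in the `Δ` zone. -/
inductive Prf (L : Signature) :
    Set (Formula L.plus) → Set (Formula L.plus) → Formula L.plus → Prop
  | hyp {Γ Δ : Set (Formula L.plus)} {φ} : φ ∈ Γ ∪ Δ → φ.Sentence → Prf L Γ Δ φ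
  | weaken {Γ Γ' Δ Δ' φ} : Γ ⊆ Γ' → Δ ⊆ Δ' → Prf L Γ Δ φ → Prf L Γ' Δ' φ
  | topIntro {Γ Δ} : Prf L Γ Δ .top
  | botElim {Γ Δ φ} : φ.Sentence → Prf L Γ Δ .bot → Prf L Γ Δ φ
  | andIntro {Γ Δ φ ψ} : Prf L Γ Δ φ → Prf L Γ Δ ψ → Prf L Γ Δ (.and φ ψ)
  | andElimL {Γ Δ φ ψ} : Prf L Γ Δ (.and φ ψ) → Prf L Γ Δ φ
  | andElimR {Γ Δ φ ψ} : Prf L Γ Δ (.and φ ψ) → Prf L Γ Δ ψ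
  | orIntroL {Γ Δ φ ψ} : ψ.Sentence → Prf L Γ Δ φ → Prf L Γ Δ (.or φ ψ)
  | orIntroR {Γ Δ φ ψ} : φ.Sentence → Prf L Γ Δ ψ → Prf L Γ Δ (.or φ ψ)
  | orElim {Γ Δ φ ψ χ} : Prf L Γ Δ (.or φ ψ) → Prf L Γ (insert φ Δ) χ →
      Prf L Γ (insert ψ Δ) χ → Prf L Γ Δ χ
  | impIntro {Γ Δ φ ψ} : φ.Sentence → Prf L Γ (insert φ Δ) ψ → Prf L Γ Δ (.imp φ ψ)
  | impElim {Γ Δ φ ψ} : Prf L Γ Δ φ → Prf L Γ ∅ (.imp φ ψ) → Prf L Γ Δ ψ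
  | intTrans {Γ Δ φ ψ χ} : Prf L Γ Δ (.imp φ ψ) → Prf L Γ Δ (.imp ψ χ) →
      Prf L Γ Δ (.imp φ χ)
  | intAndIntro {Γ Δ φ ψ χ} : Prf L Γ Δ (.imp φ ψ) → Prf L Γ Δ (.imp φ χ) →
      Prf L Γ Δ (.imp φ (.and ψ χ))
  | intOrElim {Γ Δ φ ψ χ} : Prf L Γ Δ (.imp φ χ) → Prf L Γ Δ (.imp ψ χ) →
      Prf L Γ Δ (.imp (.or φ ψ) χ)
  | intAllIntro {Γ Δ φ ψ} : φ.Sentence → Prf L Γ Δ (.all (.imp φ ψ)) →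
      Prf L Γ Δ (.imp φ (.all ψ))
  | intExElim {Γ Δ φ ψ} : ψ.Sentence → Prf L Γ Δ (.all (.imp φ ψ)) →
      Prf L Γ Δ (.imp (.ex φ) ψ)
  | allIntro {Γ Δ Γ' Δ' φ} {i : ℕ} : Γ' ⊆ Γ → Δ' ⊆ Δ → FreshIn i Γ' → FreshIn i Δ' →
      ¬ φ.OccC (Sum.inr i) → Prf L Γ' Δ' (subst0 φ (aconst L i)) → Prf L Γ Δ (.all φ)
  | allElim {Γ Δ φ} {t : Term L.plus} : t.Closed → Prf L Γ Δ (.all φ) →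
      Prf L Γ Δ (subst0 φ t)
  | cd {Γ Δ φ ψ} : φ.Sentence → Prf L Γ Δ (.all (.or φ ψ)) → Prf L Γ Δ (.or φ (.all ψ))
  | exIntro {Γ Δ φ} {t : Term L.plus} : t.Closed → (Formula.ex φ).Sentence →
      Prf L Γ Δ (subst0 φ t) → Prf L Γ Δ (.ex φ)
  | exElim {Γ Δ Γ' Δ' φ ψ} {i : ℕ} : Γ' ⊆ Γ → Δ' ⊆ Δ → FreshIn i Γ' → FreshIn i Δ' →
      ¬ φ.OccC (Sum.inr i) → ¬ ψ.OccC (Sum.inr i) → Prf L Γ Δ (.ex φ) →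
      Prf L Γ' (insert (subst0 φ (aconst L i)) Δ') ψ → Prf L Γ Δ ψ

/-- `Γ ⊢ φ`: there is a proof of `φ` from `Γ` in `NBQL_CD^r`. -/
def Prv (L : Signature) (Γ : Set (Formula L.plus)) (φ : Formula L.plus) : Prop :=
  Prf L Γ ∅ φ

end BQL

namespace BQL

/-- `PrfN L n Γ Δ φ` formalizes `Γ : Δ ⊢_{[n-1]} φ`: there is a proof of `φ` in the
system `NBQL_CD[n-1]` (so `PrfN L 0` is the system `NBQL_CD`, i.e. `⊢_{[-1]}`, which
has no modus ponens at all) whose open assumptions all belong to `Γ ∪ Δ` and in which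
every open assumption occurring unsafely (i.e. in the right main subproof of an
application of the restricted modus ponens rule) belongs to `Γ`.  The restricted
modus ponens rule of `NBQL_CD[n-1]` requires its right main subproof to lie entirely
within `NBQL_CD[m-1]` for some `m < n`. -/
inductive PrfN (L : Signature) :
    ℕ → Set (Formula L.plus) → Set (Formula L.plus) → Formula L.plus → Prop
  | hyp {n Γ Δ φ} : φ ∈ Γ ∪ Δ → φ.Sentence → PrfN L n Γ Δ φ
  | weaken {n Γ Γ' Δ Δ' φ} : Γ ⊆ Γ' → Δ ⊆ Δ' → PrfN L n Γ Δ φ → PrfN L n Γ' Δ' φ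
  | topIntro {n Γ Δ} : PrfN L n Γ Δ .top
  | botElim {n Γ Δ φ} : φ.Sentence → PrfN L n Γ Δ .bot → PrfN L n Γ Δ φ
  | andIntro {n Γ Δ φ ψ} : PrfN L n Γ Δ φ → PrfN L n Γ Δ ψ → PrfN L n Γ Δ (.and φ ψ)
  | andElimL {n Γ Δ φ ψ} : PrfN L n Γ Δ (.and φ ψ) → PrfN L n Γ Δ φ
  | andElimR {n Γ Δ φ ψ} : PrfN L n Γ Δ (.and φ ψ) → PrfN L n Γ Δ ψ
  | orIntroL {n Γ Δ φ ψ} : ψ.Sentence → PrfN L n Γ Δ φ → PrfN L n Γ Δ (.or φ ψ)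
  | orIntroR {n Γ Δ φ ψ} : φ.Sentence → PrfN L n Γ Δ ψ → PrfN L n Γ Δ (.or φ ψ)
  | orElim {n Γ Δ φ ψ χ} : PrfN L n Γ Δ (.or φ ψ) → PrfN L n Γ (insert φ Δ) χ →
      PrfN L n Γ (insert ψ Δ) χ → PrfN L n Γ Δ χ
  | impIntro {n Γ Δ φ ψ} : φ.Sentence → PrfN L n Γ (insert φ Δ) ψ →
      PrfN L n Γ Δ (.imp φ ψ)
  | impElim {n m Γ Δ φ ψ} : m < n → PrfN L n Γ Δ φ → PrfN L m Γ ∅ (.imp φ ψ) →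
      PrfN L n Γ Δ ψ
  | intTrans {n Γ Δ φ ψ χ} : PrfN L n Γ Δ (.imp φ ψ) → PrfN L n Γ Δ (.imp ψ χ) →
      PrfN L n Γ Δ (.imp φ χ)
  | intAndIntro {n Γ Δ φ ψ χ} : PrfN L n Γ Δ (.imp φ ψ) → PrfN L n Γ Δ (.imp φ χ) →
      PrfN L n Γ Δ (.imp φ (.and ψ χ))
  | intOrElim {n Γ Δ φ ψ χ} : PrfN L n Γ Δ (.imp φ χ) → PrfN L n Γ Δ (.imp ψ χ) →
      PrfN L n Γ Δ (.imp (.or φ ψ) χ)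
  | intAllIntro {n Γ Δ φ ψ} : φ.Sentence → PrfN L n Γ Δ (.all (.imp φ ψ)) →
      PrfN L n Γ Δ (.imp φ (.all ψ))
  | intExElim {n Γ Δ φ ψ} : ψ.Sentence → PrfN L n Γ Δ (.all (.imp φ ψ)) →
      PrfN L n Γ Δ (.imp (.ex φ) ψ)
  | allIntro {n Γ Δ Γ' Δ' φ} {i : ℕ} : Γ' ⊆ Γ → Δ' ⊆ Δ → FreshIn i Γ' → FreshIn i Δ' →
      ¬ φ.OccC (Sum.inr i) → PrfN L n Γ' Δ' (subst0 φ (aconst L i)) →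
      PrfN L n Γ Δ (.all φ)
  | allElim {n Γ Δ φ} {t : Term L.plus} : t.Closed → PrfN L n Γ Δ (.all φ) →
      PrfN L n Γ Δ (subst0 φ t)
  | cd {n Γ Δ φ ψ} : φ.Sentence → PrfN L n Γ Δ (.all (.or φ ψ)) →
      PrfN L n Γ Δ (.or φ (.all ψ))
  | exIntro {n Γ Δ φ} {t : Term L.plus} : t.Closed → (Formula.ex φ).Sentence →
      PrfN L n Γ Δ (subst0 φ t) → PrfN L n Γ Δ (.ex φ)
  | exElim {n Γ Δ Γ' Δ' φ ψ} {i : ℕ} : Γ' ⊆ Γ → Δ' ⊆ Δ → FreshIn i Γ' → FreshIn i Δ' →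
      ¬ φ.OccC (Sum.inr i) → ¬ ψ.OccC (Sum.inr i) → PrfN L n Γ Δ (.ex φ) →
      PrfN L n Γ' (insert (subst0 φ (aconst L i)) Δ') ψ → PrfN L n Γ Δ ψ

/-- `Γ ⊢_{[-1]} φ`: there is a proof of `φ` from `Γ` in `NBQL_CD`
(the system `NBQL_CD^r` with `→`-Elim deleted). -/
def PrvB (L : Signature) (Γ : Set (Formula L.plus)) (φ : Formula L.plus) : Prop :=
  PrfN L 0 Γ ∅ φ

end BQL

namespace BQL

open Classical in
/-- The map `s` from constants to terms, changed at `c` to take the value `t`. -/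
noncomputable def setConst {L : Signature} (s : L.Const → Term L) (c : L.Const) (t : Term L) :
    L.Const → Term L := Function.update s c t

open Classical in
theorem setConst_self {L : Signature} (s : L.Const → Term L) (c : L.Const) (t : Term L) :
    setConst s c t c = t :=
  Function.update_self ..

open Classical in
theorem setConst_of_ne {L : Signature} {s : L.Const → Term L} {c d : L.Const} {t : Term L}
    (h : d ≠ c) : setConst s c t d = s d :=
  Function.update_of_ne h ..

namespace Term

variable {L : Signature}

/-- Replace every constant of a term according to `s`. -/
def csub (s : L.Const → Term L) : Term L → Term L
  | var n => var n
  | const c => s c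
  | func f ts => func f fun i => (ts i).csub s

theorem ClosedAt.mono {t : Term L} {k m : ℕ} (hkm : k ≤ m) (h : t.ClosedAt k) :
    t.ClosedAt m := by
  induction t with
  | var n => exact lt_of_lt_of_le h hkm
  | const c => trivial
  | func f ts ih => exact fun i => ih i (h i)

theorem closedAt_shiftUp {t : Term L} {k : ℕ} : t.shiftUp.ClosedAt (k + 1) ↔ t.ClosedAt k := by
  induction t with
  | var n => simp [shiftUp, ClosedAt]
  | const c => simp [shiftUp, ClosedAt]
  | func f ts ih => simp [shiftUp, ClosedAt, ih]

theorem Closed.shiftUp_eq {t : Term L} (h : t.Closed) : t.shiftUp = t := by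
  induction t with
  | var n => exact absurd h (Nat.not_lt_zero n)
  | const c => rfl
  | func f ts ih =>
    simp only [shiftUp]
    congr 1
    exact funext fun i => ih i (h i)

theorem ClosedAt.applySub_eq {t : Term L} {k : ℕ} {σ : ℕ → Term L}
    (hσ : ∀ n < k, σ n = var n) (h : t.ClosedAt k) : t.applySub σ = t := by
  induction t with
  | var n => exact hσ n h
  | const c => rfl
  | func f ts ih =>
    simp only [applySub]
    congr 1
    exact funext fun i => ih i (h i)

theorem ClosedAt.applySub {t : Term L} {k m : ℕ} {σ : ℕ → Term L}
    (hσ : ∀ n < m, (σ n).ClosedAt k) (h : t.ClosedAt m) : (t.applySub σ).ClosedAt k := by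
  induction t with
  | var n => exact hσ n h
  | const c => trivial
  | func f ts ih => exact fun i => ih i (h i)

theorem ClosedAt.of_applySub {t : Term L} {k m : ℕ} {σ : ℕ → Term L}
    (hσ : ∀ n, (σ n).ClosedAt k → n < m) (h : (t.applySub σ).ClosedAt k) : t.ClosedAt m := by
  induction t with
  | var n => exact hσ n h
  | const c => trivial
  | func f ts ih => exact fun i => ih i (h i)

theorem ClosedAt.csub {t : Term L} {k : ℕ} {s : L.Const → Term L} (hs : ∀ c, (s c).Closed)
    (h : t.ClosedAt k) : (t.csub s).ClosedAt k := by
  induction t with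
  | var n => exact h
  | const c => exact (hs c).mono (Nat.zero_le k)
  | func f ts ih => exact fun i => ih i (h i)

theorem csub_const (t : Term L) : t.csub const = t := by
  induction t with
  | var n => rfl
  | const c => rfl
  | func f ts ih => simp [csub, ih]

theorem csub_setConst {t : Term L} {s : L.Const → Term L} {c : L.Const} {u : Term L}
    (h : ¬ t.OccC c) : t.csub (setConst s c u) = t.csub s := by
  induction t with
  | var n => rfl
  | const d => exact setConst_of_ne h
  | func f ts ih =>
    simp only [csub]
    congr 1
    exact funext fun i => ih i fun hi => h ⟨i, hi⟩

theorem csub_shiftUp {s : L.Const → Term L} (hs : ∀ c, (s c).Closed) (t : Term L) :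
    t.shiftUp.csub s = (t.csub s).shiftUp := by
  induction t with
  | var n => rfl
  | const c => exact (hs c).shiftUp_eq.symm
  | func f ts ih => simp [csub, shiftUp, ih]

theorem csub_applySub {s : L.Const → Term L} (hs : ∀ c, (s c).Closed) (t : Term L)
    (σ : ℕ → Term L) :
    (t.applySub σ).csub s = (t.csub s).applySub fun n => (σ n).csub s := by
  induction t with
  | var n => rfl
  | const c => exact (ClosedAt.applySub_eq (fun n hn => absurd hn n.not_lt_zero) (hs c)).symm
  | func f ts ih => simp [csub, applySub, ih]

theorem finite_setOf_occC (t : Term L) : {c | t.OccC c}.Finite := by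
  induction t with
  | var n => simp [OccC]
  | const d => simp [OccC]
  | func f ts ih =>
    simp only [OccC, Set.ofPred_exists]
    exact Set.finite_iUnion ih

end Term

section Lift

variable {L : Signature}

theorem liftSub_eq_var {σ : ℕ → Term L} {k : ℕ} (hσ : ∀ n < k, σ n = .var n) :
    ∀ n < k + 1, liftSub σ n = .var n
  | 0, _ => rfl
  | n + 1, h => by simp [liftSub, hσ n (Nat.lt_of_succ_lt_succ h), Term.shiftUp]

theorem closedAt_liftSub {σ : ℕ → Term L} {k m : ℕ} (hσ : ∀ n < m, (σ n).ClosedAt k) :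
    ∀ n < m + 1, (liftSub σ n).ClosedAt (k + 1)
  | 0, _ => Nat.succ_pos k
  | n + 1, h => Term.closedAt_shiftUp.2 (hσ n (Nat.lt_of_succ_lt_succ h))

theorem lt_of_closedAt_liftSub {σ : ℕ → Term L} {k m : ℕ}
    (hσ : ∀ n, (σ n).ClosedAt k → n < m) :
    ∀ n, (liftSub σ n).ClosedAt (k + 1) → n < m + 1
  | 0, _ => Nat.succ_pos m
  | n + 1, h => Nat.succ_lt_succ (hσ n (Term.closedAt_shiftUp.1 h))

theorem csub_liftSub {s : L.Const → Term L} (hs : ∀ c, (s c).Closed) (σ : ℕ → Term L) :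
    (fun n => (liftSub σ n).csub s) = liftSub fun n => (σ n).csub s := by
  funext n
  cases n with
  | zero => rfl
  | succ n => exact Term.csub_shiftUp hs (σ n)

end Lift

namespace Formula

variable {L : Signature}

/-- Replace every constant of a formula according to `s`, whose values are meant to be closed. -/
def csub (s : L.Const → Term L) : Formula L → Formula L
  | top => top
  | bot => bot
  | rel R ts => rel R fun i => (ts i).csub s
  | and φ ψ => and (φ.csub s) (ψ.csub s)
  | or φ ψ => or (φ.csub s) (ψ.csub s)
  | imp φ ψ => imp (φ.csub s) (ψ.csub s)
  | all φ => all (φ.csub s)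
  | ex φ => ex (φ.csub s)

/-- The number of connectives and quantifiers of a formula. -/
def size : Formula L → ℕ
  | top => 0
  | bot => 0
  | rel _ _ => 0
  | and φ ψ => φ.size + ψ.size + 1
  | or φ ψ => φ.size + ψ.size + 1
  | imp φ ψ => φ.size + ψ.size + 1
  | all φ => φ.size + 1
  | ex φ => φ.size + 1

theorem size_applySub (φ : Formula L) (σ : ℕ → Term L) : (φ.applySub σ).size = φ.size := by
  induction φ generalizing σ <;> simp_all [applySub, size]

theorem size_subst0 (φ : Formula L) (t : Term L) : (subst0 φ t).size = φ.size :=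
  size_applySub φ _

theorem ClosedAt.applySub_eq {φ : Formula L} {k : ℕ} {σ : ℕ → Term L}
    (hσ : ∀ n < k, σ n = .var n) (h : φ.ClosedAt k) : φ.applySub σ = φ := by
  induction φ generalizing k σ with
  | top => rfl
  | bot => rfl
  | rel R ts =>
    simp only [applySub]
    congr 1
    exact funext fun i => (h i).applySub_eq hσ
  | and φ ψ ih₁ ih₂ => simp [applySub, ih₁ hσ h.1, ih₂ hσ h.2]
  | or φ ψ ih₁ ih₂ => simp [applySub, ih₁ hσ h.1, ih₂ hσ h.2]
  | imp φ ψ ih₁ ih₂ => simp [applySub, ih₁ hσ h.1, ih₂ hσ h.2]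
  | all φ ih => simp [applySub, ih (liftSub_eq_var hσ) h]
  | ex φ ih => simp [applySub, ih (liftSub_eq_var hσ) h]

theorem Sentence.subst0_eq {φ : Formula L} (h : φ.Sentence) (t : Term L) : subst0 φ t = φ :=
  ClosedAt.applySub_eq (fun n hn => absurd hn n.not_lt_zero) h

theorem ClosedAt.applySub {φ : Formula L} {k m : ℕ} {σ : ℕ → Term L}
    (hσ : ∀ n < m, (σ n).ClosedAt k) (h : φ.ClosedAt m) : (φ.applySub σ).ClosedAt k := by
  induction φ generalizing k m σ with
  | top => trivial
  | bot => trivial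
  | rel R ts => exact fun i => (h i).applySub hσ
  | and φ ψ ih₁ ih₂ => exact ⟨ih₁ hσ h.1, ih₂ hσ h.2⟩
  | or φ ψ ih₁ ih₂ => exact ⟨ih₁ hσ h.1, ih₂ hσ h.2⟩
  | imp φ ψ ih₁ ih₂ => exact ⟨ih₁ hσ h.1, ih₂ hσ h.2⟩
  | all φ ih => exact ih (closedAt_liftSub hσ) h
  | ex φ ih => exact ih (closedAt_liftSub hσ) h

theorem ClosedAt.of_applySub {φ : Formula L} {k m : ℕ} {σ : ℕ → Term L}
    (hσ : ∀ n, (σ n).ClosedAt k → n < m) (h : (φ.applySub σ).ClosedAt k) : φ.ClosedAt m := by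
  induction φ generalizing k m σ with
  | top => trivial
  | bot => trivial
  | rel R ts => exact fun i => (h i).of_applySub hσ
  | and φ ψ ih₁ ih₂ => exact ⟨ih₁ hσ h.1, ih₂ hσ h.2⟩
  | or φ ψ ih₁ ih₂ => exact ⟨ih₁ hσ h.1, ih₂ hσ h.2⟩
  | imp φ ψ ih₁ ih₂ => exact ⟨ih₁ hσ h.1, ih₂ hσ h.2⟩
  | all φ ih => exact ih (lt_of_closedAt_liftSub hσ) h
  | ex φ ih => exact ih (lt_of_closedAt_liftSub hσ) h

theorem ClosedAt.subst0 {φ : Formula L} (h : φ.ClosedAt 1) {t : Term L} (ht : t.Closed) :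
    (subst0 φ t).Sentence := by
  refine ClosedAt.applySub (fun n hn => ?_) h
  obtain rfl : n = 0 := by omega
  exact ht

theorem closedAt_one_of_subst0 {φ : Formula L} {t : Term L} (h : (subst0 φ t).Sentence) :
    φ.ClosedAt 1 := by
  refine ClosedAt.of_applySub (fun n hn => ?_) h
  cases n with
  | zero => exact Nat.one_pos
  | succ n => exact absurd hn n.not_lt_zero

theorem ClosedAt.csub {φ : Formula L} {k : ℕ} {s : L.Const → Term L} (hs : ∀ c, (s c).Closed)
    (h : φ.ClosedAt k) : (φ.csub s).ClosedAt k := by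
  induction φ generalizing k with
  | top => trivial
  | bot => trivial
  | rel R ts => exact fun i => (h i).csub hs
  | and φ ψ ih₁ ih₂ => exact ⟨ih₁ h.1, ih₂ h.2⟩
  | or φ ψ ih₁ ih₂ => exact ⟨ih₁ h.1, ih₂ h.2⟩
  | imp φ ψ ih₁ ih₂ => exact ⟨ih₁ h.1, ih₂ h.2⟩
  | all φ ih => exact ih h
  | ex φ ih => exact ih h

theorem Sentence.csub {φ : Formula L} (h : φ.Sentence) {s : L.Const → Term L}
    (hs : ∀ c, (s c).Closed) : (φ.csub s).Sentence :=
  ClosedAt.csub hs h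

theorem csub_const (φ : Formula L) : φ.csub .const = φ := by
  induction φ <;> simp_all [csub, Term.csub_const]

theorem csub_setConst {φ : Formula L} {s : L.Const → Term L} {c : L.Const} {u : Term L}
    (h : ¬ φ.OccC c) : φ.csub (setConst s c u) = φ.csub s := by
  induction φ with
  | top => rfl
  | bot => rfl
  | rel R ts =>
    simp only [csub]
    congr 1
    exact funext fun i => Term.csub_setConst fun hi => h ⟨i, hi⟩
  | and φ ψ ih₁ ih₂ =>
    simp [csub, ih₁ fun h' => h (Or.inl h'), ih₂ fun h' => h (Or.inr h')]
  | or φ ψ ih₁ ih₂ =>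
    simp [csub, ih₁ fun h' => h (Or.inl h'), ih₂ fun h' => h (Or.inr h')]
  | imp φ ψ ih₁ ih₂ =>
    simp [csub, ih₁ fun h' => h (Or.inl h'), ih₂ fun h' => h (Or.inr h')]
  | all φ ih => simp [csub, ih h]
  | ex φ ih => simp [csub, ih h]

theorem csub_applySub {s : L.Const → Term L} (hs : ∀ c, (s c).Closed) (φ : Formula L)
    (σ : ℕ → Term L) :
    (φ.applySub σ).csub s = (φ.csub s).applySub fun n => (σ n).csub s := by
  induction φ generalizing σ <;>
    simp_all [csub, applySub, Term.csub_applySub hs, csub_liftSub hs]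

theorem csub_subst0 {s : L.Const → Term L} (hs : ∀ c, (s c).Closed) (φ : Formula L)
    (t : Term L) : (subst0 φ t).csub s = subst0 (φ.csub s) (t.csub s) := by
  simp only [subst0, csub_applySub hs]
  congr 1
  funext n
  cases n <;> rfl

theorem finite_setOf_occC (φ : Formula L) : {c | φ.OccC c}.Finite := by
  induction φ with
  | top => simp [OccC]
  | bot => simp [OccC]
  | rel R ts =>
    simp only [OccC, Set.ofPred_exists]
    exact Set.finite_iUnion fun i => (ts i).finite_setOf_occC
  | and φ ψ ih₁ ih₂ => exact ih₁.union ih₂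
  | or φ ψ ih₁ ih₂ => exact ih₁.union ih₂
  | imp φ ψ ih₁ ih₂ => exact ih₁.union ih₂
  | all φ ih => exact ih
  | ex φ ih => exact ih

end Formula

variable {L : Signature}

theorem closed_setConst {s : L.Const → Term L} (hs : ∀ c, (s c).Closed) (c : L.Const)
    {t : Term L} (ht : t.Closed) (d : L.Const) : (setConst s c t d).Closed := by
  by_cases h : d = c
  · subst h
    rwa [setConst_self]
  · rw [setConst_of_ne h]
    exact hs d

theorem closed_aconst (i : ℕ) : (aconst L i).Closed := trivial

theorem csub_aconst_setConst (s : L.plus.Const → Term L.plus) (i : ℕ) (t : Term L.plus) :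
    (aconst L i).csub (setConst s (Sum.inr i) t) = t :=
  setConst_self s _ t

theorem csub_subst0_aconst {s : L.plus.Const → Term L.plus} (hs : ∀ c, (s c).Closed) {i : ℕ}
    {φ : Formula L.plus} (hi : ¬ φ.OccC (Sum.inr i)) {t : Term L.plus} (ht : t.Closed) :
    (subst0 φ (aconst L i)).csub (setConst s (Sum.inr i) t) = subst0 (φ.csub s) t := by
  refine (Formula.csub_subst0 (closed_setConst hs _ ht) _ _).trans ?_
  exact congrArg₂ subst0 (Formula.csub_setConst hi) (csub_aconst_setConst s i t)

theorem exists_freshIn {Δ : Set (Formula L.plus)} (hΔ : Δ.Finite) : ∃ i, FreshIn i Δ := by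
  have h : (⋃ ψ ∈ Δ, {i : ℕ | ψ.OccC (Sum.inr i)}).Finite :=
    hΔ.biUnion fun ψ _ => ψ.finite_setOf_occC.preimage Sum.inr_injective.injOn
  obtain ⟨i, hi⟩ := h.exists_notMem
  exact ⟨i, fun ψ hψ hocc => hi (Set.mem_biUnion hψ hocc)⟩

theorem freshIn_empty (i : ℕ) : FreshIn i (∅ : Set (Formula L.plus)) := fun _ h => h.elim

namespace PrfN

variable {Γ Δ : Set (Formula L.plus)} {φ ψ : Formula L.plus} {n : ℕ}

theorem sentence (h : PrfN L n Γ Δ φ) : φ.Sentence := by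
  induction h with
  | hyp _ h => exact h
  | weaken _ _ _ ih => exact ih
  | topIntro => trivial
  | botElim h _ _ => exact h
  | andIntro _ _ ih₁ ih₂ => exact ⟨ih₁, ih₂⟩
  | andElimL _ ih => exact ih.1
  | andElimR _ ih => exact ih.2
  | orIntroL h _ ih => exact ⟨ih, h⟩
  | orIntroR h _ ih => exact ⟨h, ih⟩
  | orElim _ _ _ _ ih _ => exact ih
  | impIntro h _ ih => exact ⟨h, ih⟩
  | impElim _ _ _ _ ih => exact ih.2
  | intTrans _ _ ih₁ ih₂ => exact ⟨ih₁.1, ih₂.2⟩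
  | intAndIntro _ _ ih₁ ih₂ => exact ⟨ih₁.1, ih₁.2, ih₂.2⟩
  | intOrElim _ _ ih₁ ih₂ => exact ⟨⟨ih₁.1, ih₂.1⟩, ih₁.2⟩
  | intAllIntro h _ ih => exact ⟨h, ih.2⟩
  | intExElim h _ ih => exact ⟨ih.1, h⟩
  | allIntro _ _ _ _ _ _ ih => exact Formula.closedAt_one_of_subst0 ih
  | allElim ht _ ih => exact Formula.ClosedAt.subst0 ih ht
  | cd h _ ih => exact ⟨h, ih.2⟩
  | exIntro _ h _ _ => exact h
  | exElim _ _ _ _ _ _ _ _ _ ih => exact ih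

theorem cut (h₁ : PrfN L n Γ Δ φ) (h₂ : PrfN L n Γ (insert φ Δ) ψ) : PrfN L n Γ Δ ψ :=
  orElim (orIntroL h₁.sentence h₁) h₂ h₂

theorem hyp_insert (h : φ.Sentence) : PrfN L n Γ (insert φ Δ) φ :=
  hyp (Or.inr (Set.mem_insert _ _)) h

theorem hyp_singleton (h : φ.Sentence) : PrfN L n Γ {φ} φ :=
  hyp (Or.inr (Set.mem_singleton _)) h

theorem weaken_insert (h : PrfN L n Γ Δ φ) : PrfN L n Γ (insert ψ Δ) φ :=
  weaken subset_rfl (Set.subset_insert _ _) h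

/-- Closed terms may be substituted for constants, and assumptions may be replaced by proofs. -/
theorem csub (h : PrfN L n Γ Δ φ) (hn : n = 0) {s : L.plus.Const → Term L.plus}
    (hs : ∀ c, (s c).Closed) {Θ : Set (Formula L.plus)} (hΘ : Θ.Finite)
    (H : ∀ δ ∈ Γ ∪ Δ, δ.Sentence → PrfN L 0 ∅ Θ (δ.csub s)) : PrfN L 0 ∅ Θ (φ.csub s) := by
  have push {Γ Δ : Set (Formula L.plus)} {ψ : Formula L.plus} {s : L.plus.Const → Term L.plus}
      {Θ : Set (Formula L.plus)} (hs : ∀ c, (s c).Closed)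
      (H : ∀ δ ∈ Γ ∪ Δ, δ.Sentence → PrfN L 0 ∅ Θ (δ.csub s)) :
      ∀ δ ∈ Γ ∪ insert ψ Δ, δ.Sentence → PrfN L 0 ∅ (insert (ψ.csub s) Θ) (δ.csub s) := by
    rintro δ (hδ | rfl | hδ) hδs
    · exact (H δ (Or.inl hδ) hδs).weaken_insert
    · exact hyp_insert (hδs.csub hs)
    · exact (H δ (Or.inr hδ) hδs).weaken_insert
  induction h generalizing s Θ with
  | hyp hm h => exact H _ hm h
  | weaken h₁ h₂ _ ih => exact ih hn hs hΘ fun δ hδ => H δ (Set.union_subset_union h₁ h₂ hδ)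
  | topIntro => exact topIntro
  | botElim h _ ih => exact botElim (h.csub hs) (ih hn hs hΘ H)
  | andIntro _ _ ih₁ ih₂ => exact andIntro (ih₁ hn hs hΘ H) (ih₂ hn hs hΘ H)
  | andElimL _ ih => exact andElimL (ih hn hs hΘ H)
  | andElimR _ ih => exact andElimR (ih hn hs hΘ H)
  | orIntroL h _ ih => exact orIntroL (h.csub hs) (ih hn hs hΘ H)
  | orIntroR h _ ih => exact orIntroR (h.csub hs) (ih hn hs hΘ H)
  | orElim _ _ _ ih ih₁ ih₂ =>
    exact orElim (ih hn hs hΘ H) (ih₁ hn hs (hΘ.insert _) (push hs H))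
      (ih₂ hn hs (hΘ.insert _) (push hs H))
  | impIntro h _ ih => exact impIntro (h.csub hs) (ih hn hs (hΘ.insert _) (push hs H))
  | impElim hlt => omega
  | intTrans _ _ ih₁ ih₂ => exact intTrans (ih₁ hn hs hΘ H) (ih₂ hn hs hΘ H)
  | intAndIntro _ _ ih₁ ih₂ => exact intAndIntro (ih₁ hn hs hΘ H) (ih₂ hn hs hΘ H)
  | intOrElim _ _ ih₁ ih₂ => exact intOrElim (ih₁ hn hs hΘ H) (ih₂ hn hs hΘ H)
  | intAllIntro h _ ih => exact intAllIntro (h.csub hs) (ih hn hs hΘ H)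
  | intExElim h _ ih => exact intExElim (h.csub hs) (ih hn hs hΘ H)
  | @allIntro _ Γ Δ Γ' Δ' φ i h₁ h₂ f₁ f₂ hi _ ih =>
    obtain ⟨j, hj⟩ := exists_freshIn (hΘ.insert (φ.csub s))
    refine allIntro (i := j) subset_rfl subset_rfl (freshIn_empty j)
      (fun ψ hψ => hj ψ (Or.inr hψ)) (hj _ (Or.inl rfl)) ?_
    rw [← csub_subst0_aconst hs hi (closed_aconst j)]
    refine ih hn (closed_setConst hs _ (closed_aconst j)) hΘ fun δ hδ hδs => ?_
    rw [Formula.csub_setConst (hδ.elim (f₁ δ) (f₂ δ))]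
    exact H δ (Set.union_subset_union h₁ h₂ hδ) hδs
  | @allElim _ _ _ φ t ht _ ih =>
    rw [Formula.csub_subst0 hs]
    exact allElim (Term.ClosedAt.csub hs ht) (ih hn hs hΘ H)
  | cd h _ ih => exact cd (h.csub hs) (ih hn hs hΘ H)
  | @exIntro _ _ _ φ t ht h _ ih =>
    refine exIntro (Term.ClosedAt.csub hs ht) (h.csub hs) ?_
    rw [← Formula.csub_subst0 hs]
    exact ih hn hs hΘ H
  | @exElim _ Γ Δ Γ' Δ' φ ψ i h₁ h₂ f₁ f₂ hi hi' _ _ ih₁ ih₂ =>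
    obtain ⟨j, hj⟩ := exists_freshIn ((hΘ.insert (ψ.csub s)).insert (φ.csub s))
    refine exElim (i := j) subset_rfl subset_rfl (freshIn_empty j)
      (fun ψ hψ => hj ψ (Or.inr (Or.inr hψ))) (hj _ (Or.inl rfl)) (hj _ (Or.inr (Or.inl rfl)))
      (ih₁ hn hs hΘ H) ?_
    have hs' := closed_setConst hs (Sum.inr i) (closed_aconst (L := L) j)
    rw [← csub_subst0_aconst hs hi (closed_aconst j), ← Formula.csub_setConst hi']
    refine ih₂ hn hs' (hΘ.insert _) (push hs' fun δ hδ hδs => ?_)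
    rw [Formula.csub_setConst (hδ.elim (f₁ δ) (f₂ δ))]
    exact H δ (Set.union_subset_union h₁ h₂ hδ) hδs

theorem toPrf (h : PrfN L n Γ Δ φ) : Prf L Γ Δ φ := by
  induction h with
  | hyp hm h => exact .hyp hm h
  | weaken h₁ h₂ _ ih => exact .weaken h₁ h₂ ih
  | topIntro => exact .topIntro
  | botElim h _ ih => exact .botElim h ih
  | andIntro _ _ ih₁ ih₂ => exact .andIntro ih₁ ih₂
  | andElimL _ ih => exact .andElimL ih
  | andElimR _ ih => exact .andElimR ih
  | orIntroL h _ ih => exact .orIntroL h ih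
  | orIntroR h _ ih => exact .orIntroR h ih
  | orElim _ _ _ ih ih₁ ih₂ => exact .orElim ih ih₁ ih₂
  | impIntro h _ ih => exact .impIntro h ih
  | impElim _ _ _ ih₁ ih₂ => exact .impElim ih₁ ih₂
  | intTrans _ _ ih₁ ih₂ => exact .intTrans ih₁ ih₂
  | intAndIntro _ _ ih₁ ih₂ => exact .intAndIntro ih₁ ih₂
  | intOrElim _ _ ih₁ ih₂ => exact .intOrElim ih₁ ih₂
  | intAllIntro h _ ih => exact .intAllIntro h ih
  | intExElim h _ ih => exact .intExElim h ih
  | allIntro h₁ h₂ f₁ f₂ hi _ ih => exact .allIntro h₁ h₂ f₁ f₂ hi ih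
  | allElim ht _ ih => exact .allElim ht ih
  | cd h _ ih => exact .cd h ih
  | exIntro ht h _ ih => exact .exIntro ht h ih
  | exElim h₁ h₂ f₁ f₂ hi hi' _ _ ih₁ ih₂ => exact .exElim h₁ h₂ f₁ f₂ hi hi' ih₁ ih₂

end PrfN

/-- Truth at a root placed below the canonical model of `NBQL_CD`, where no atom holds: an
implication holds there iff its consequent is provable from its antecedent. -/
def Slash : Formula L.plus → Prop
  | .top => True
  | .bot => False
  | .rel _ _ => False
  | .and φ ψ => Slash φ ∧ Slash ψ
  | .or φ ψ => Slash φ ∨ Slash ψ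
  | .imp φ ψ => PrfN L 0 ∅ {φ} ψ
  | .all φ => ∀ t : Term L.plus, t.Closed → Slash (subst0 φ t)
  | .ex φ => ∃ t : Term L.plus, t.Closed ∧ Slash (subst0 φ t)
termination_by φ => φ.size
decreasing_by all_goals simp only [Formula.size, Formula.size_subst0]; omega

theorem Slash.prf : ∀ {φ : Formula L.plus}, φ.Sentence → Slash φ → PrfN L 0 ∅ ∅ φ
  | .top, _, _ => .topIntro
  | .bot, _, h => by simp [Slash] at h
  | .rel _ _, _, h => by simp [Slash] at h
  | .and φ ψ, hs, h => by
    rw [Slash] at h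
    exact .andIntro (Slash.prf hs.1 h.1) (Slash.prf hs.2 h.2)
  | .or φ ψ, hs, h => by
    rw [Slash] at h
    rcases h with h | h
    · exact .orIntroL hs.2 (Slash.prf hs.1 h)
    · exact .orIntroR hs.1 (Slash.prf hs.2 h)
  | .imp φ ψ, hs, h => by
    rw [Slash] at h
    exact .impIntro hs.1 (by simpa using h)
  | .all φ, hs, h => by
    rw [Slash] at h
    obtain ⟨i, hi⟩ := exists_freshIn (Set.finite_singleton φ)
    exact .allIntro subset_rfl subset_rfl (freshIn_empty i) (freshIn_empty i) (hi φ rfl)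
      (Slash.prf (Formula.ClosedAt.subst0 hs (closed_aconst i)) (h _ (closed_aconst i)))
  | .ex φ, hs, h => by
    rw [Slash] at h
    obtain ⟨t, ht, h⟩ := h
    exact .exIntro ht hs (Slash.prf (Formula.ClosedAt.subst0 hs ht) h)
termination_by φ => φ.size
decreasing_by all_goals simp only [Formula.size, Formula.size_subst0]; omega

theorem PrfN.slash {Γ Δ : Set (Formula L.plus)} {φ : Formula L.plus} {n : ℕ}
    (h : PrfN L n Γ Δ φ) (hn : n = 0) {s : L.plus.Const → Term L.plus}
    (hs : ∀ c, (s c).Closed) (H : ∀ δ ∈ Γ ∪ Δ, δ.Sentence → Slash (δ.csub s)) :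
    Slash (φ.csub s) := by
  have push {Γ Δ : Set (Formula L.plus)} {ψ : Formula L.plus} {s : L.plus.Const → Term L.plus}
      (H : ∀ δ ∈ Γ ∪ Δ, δ.Sentence → Slash (δ.csub s)) (hψ : Slash (ψ.csub s)) :
      ∀ δ ∈ Γ ∪ insert ψ Δ, δ.Sentence → Slash (δ.csub s) := by
    rintro δ (hδ | rfl | hδ) hδs
    · exact H δ (Or.inl hδ) hδs
    · exact hψ
    · exact H δ (Or.inr hδ) hδs
  induction h generalizing s with
  | hyp hm h => exact H _ hm h
  | weaken h₁ h₂ _ ih => exact ih hn hs fun δ hδ => H δ (Set.union_subset_union h₁ h₂ hδ)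
  | topIntro => simp [Formula.csub, Slash]
  | botElim h _ ih =>
    have := ih hn hs H
    simp [Formula.csub, Slash] at this
  | andIntro _ _ ih₁ ih₂ =>
    rw [Formula.csub, Slash]
    exact ⟨ih₁ hn hs H, ih₂ hn hs H⟩
  | andElimL _ ih =>
    have := ih hn hs H
    rw [Formula.csub, Slash] at this
    exact this.1
  | andElimR _ ih =>
    have := ih hn hs H
    rw [Formula.csub, Slash] at this
    exact this.2
  | orIntroL h _ ih =>
    rw [Formula.csub, Slash]
    exact Or.inl (ih hn hs H)
  | orIntroR h _ ih =>
    rw [Formula.csub, Slash]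
    exact Or.inr (ih hn hs H)
  | orElim _ _ _ ih ih₁ ih₂ =>
    have := ih hn hs H
    rw [Formula.csub, Slash] at this
    rcases this with h | h
    · exact ih₁ hn hs (push H h)
    · exact ih₂ hn hs (push H h)
  | impIntro h d _ =>
    rw [Formula.csub, Slash]
    refine d.csub hn hs (Set.finite_singleton _) ?_
    rintro δ (hδ | rfl | hδ) hδs
    · exact ((H δ (Or.inl hδ) hδs).prf (hδs.csub hs)).weaken subset_rfl (Set.empty_subset _)
    · exact .hyp_singleton (hδs.csub hs)
    · exact ((H δ (Or.inr hδ) hδs).prf (hδs.csub hs)).weaken subset_rfl (Set.empty_subset _)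
  | impElim hlt => omega
  | intTrans _ _ ih₁ ih₂ =>
    have h₁ := ih₁ hn hs H
    have h₂ := ih₂ hn hs H
    rw [Formula.csub, Slash] at h₁ h₂ ⊢
    exact h₁.cut (h₂.weaken subset_rfl (by simp))
  | intAndIntro _ _ ih₁ ih₂ =>
    have h₁ := ih₁ hn hs H
    have h₂ := ih₂ hn hs H
    simp only [Formula.csub, Slash] at h₁ h₂ ⊢
    exact h₁.andIntro h₂
  | intOrElim d₁ d₂ ih₁ ih₂ =>
    have h₁ := ih₁ hn hs H
    have h₂ := ih₂ hn hs H
    simp only [Formula.csub, Slash] at h₁ h₂ ⊢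
    have hor : (Formula.or _ _).Sentence := ⟨d₁.sentence.1.csub hs, d₂.sentence.1.csub hs⟩
    exact .orElim (.hyp_singleton hor) (h₁.weaken subset_rfl (by simp))
      (h₂.weaken subset_rfl (by simp))
  | @intAllIntro _ _ _ φ ψ h _ ih =>
    have h₁ := ih hn hs H
    simp only [Formula.csub, Slash] at h₁ ⊢
    obtain ⟨i, hi⟩ := exists_freshIn (Set.toFinite {φ.csub s, ψ.csub s})
    have h₂ := h₁ _ (closed_aconst i)
    rw [subst0, Formula.applySub, Slash, ← subst0, ← subst0, (h.csub hs).subst0_eq] at h₂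
    exact .allIntro subset_rfl subset_rfl (freshIn_empty i)
      (fun δ hδ => hi δ (Or.inl hδ)) (hi _ (Or.inr rfl)) h₂
  | @intExElim _ _ _ φ ψ h d ih =>
    have h₁ := ih hn hs H
    simp only [Formula.csub, Slash] at h₁ ⊢
    obtain ⟨i, hi⟩ := exists_freshIn (Set.toFinite {φ.csub s, ψ.csub s})
    have h₂ := h₁ _ (closed_aconst i)
    rw [subst0, Formula.applySub, Slash, ← subst0, ← subst0, (h.csub hs).subst0_eq] at h₂
    have hex : (Formula.ex (φ.csub s)).Sentence := Formula.ClosedAt.csub hs d.sentence.1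
    exact .exElim subset_rfl (Set.empty_subset _) (freshIn_empty i) (freshIn_empty i)
      (hi _ (Or.inl rfl)) (hi _ (Or.inr rfl)) (.hyp_singleton hex) (by simpa using h₂)
  | @allIntro _ Γ Δ Γ' Δ' φ i h₁ h₂ f₁ f₂ hi _ ih =>
    rw [Formula.csub, Slash]
    intro t ht
    rw [← csub_subst0_aconst hs hi ht]
    refine ih hn (closed_setConst hs _ ht) fun δ hδ hδs => ?_
    rw [Formula.csub_setConst (hδ.elim (f₁ δ) (f₂ δ))]
    exact H δ (Set.union_subset_union h₁ h₂ hδ) hδs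
  | @allElim _ _ _ φ t ht _ ih =>
    have h₁ := ih hn hs H
    rw [Formula.csub, Slash] at h₁
    rw [Formula.csub_subst0 hs]
    exact h₁ _ (Term.ClosedAt.csub hs ht)
  | @cd _ _ _ φ ψ h _ ih =>
    have h₁ := ih hn hs H
    simp only [Formula.csub, Slash] at h₁ ⊢
    refine or_iff_not_imp_left.2 fun hφ t ht => ?_
    have h₂ := h₁ t ht
    rw [subst0, Formula.applySub, Slash, ← subst0, ← subst0, (h.csub hs).subst0_eq] at h₂
    exact h₂.resolve_left hφ
  | @exIntro _ _ _ φ t ht h _ ih =>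
    rw [Formula.csub, Slash]
    refine ⟨_, Term.ClosedAt.csub hs ht, ?_⟩
    rw [← Formula.csub_subst0 hs]
    exact ih hn hs H
  | @exElim _ Γ Δ Γ' Δ' φ ψ i h₁ h₂ f₁ f₂ hi hi' _ _ ih₁ ih₂ =>
    have h₃ := ih₁ hn hs H
    rw [Formula.csub, Slash] at h₃
    obtain ⟨t, ht, h₃⟩ := h₃
    rw [← csub_subst0_aconst hs hi ht] at h₃
    rw [← Formula.csub_setConst hi']
    refine ih₂ hn (closed_setConst hs _ ht) (push (fun δ hδ hδs => ?_) h₃)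
    rw [Formula.csub_setConst (hδ.elim (f₁ δ) (f₂ δ))]
    exact H δ (Set.union_subset_union h₁ h₂ hδ) hδs

/-- Modus ponens with a provable implication is admissible in `NBQL_CD`. -/
theorem PrfN.impElim_admissible {Δ : Set (Formula L.plus)} {φ ψ : Formula L.plus}
    (h₁ : PrfN L 0 ∅ Δ φ) (h₂ : PrfN L 0 ∅ ∅ (.imp φ ψ)) : PrfN L 0 ∅ Δ ψ := by
  have h := h₂.slash rfl (s := .const) (fun _ => trivial) (by simp)
  rw [Formula.csub_const, Slash] at h
  exact h₁.cut (h.weaken subset_rfl (by simp))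

theorem Prf.toPrfN {Γ Δ : Set (Formula L.plus)} {φ : Formula L.plus} (h : Prf L Γ Δ φ)
    (hΓ : Γ = ∅) : PrfN L 0 Γ Δ φ := by
  induction h with
  | hyp hm h => exact .hyp hm h
  | weaken h₁ h₂ _ ih => exact .weaken h₁ h₂ (ih (Set.subset_eq_empty h₁ hΓ))
  | topIntro => exact .topIntro
  | botElim h _ ih => exact .botElim h (ih hΓ)
  | andIntro _ _ ih₁ ih₂ => exact .andIntro (ih₁ hΓ) (ih₂ hΓ)
  | andElimL _ ih => exact .andElimL (ih hΓ)
  | andElimR _ ih => exact .andElimR (ih hΓ)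
  | orIntroL h _ ih => exact .orIntroL h (ih hΓ)
  | orIntroR h _ ih => exact .orIntroR h (ih hΓ)
  | orElim _ _ _ ih ih₁ ih₂ => exact .orElim (ih hΓ) (ih₁ hΓ) (ih₂ hΓ)
  | impIntro h _ ih => exact .impIntro h (ih hΓ)
  | impElim _ _ ih₁ ih₂ =>
    subst hΓ
    exact (ih₁ rfl).impElim_admissible (ih₂ rfl)
  | intTrans _ _ ih₁ ih₂ => exact .intTrans (ih₁ hΓ) (ih₂ hΓ)
  | intAndIntro _ _ ih₁ ih₂ => exact .intAndIntro (ih₁ hΓ) (ih₂ hΓ)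
  | intOrElim _ _ ih₁ ih₂ => exact .intOrElim (ih₁ hΓ) (ih₂ hΓ)
  | intAllIntro h _ ih => exact .intAllIntro h (ih hΓ)
  | intExElim h _ ih => exact .intExElim h (ih hΓ)
  | allIntro h₁ h₂ f₁ f₂ hi _ ih =>
    exact .allIntro h₁ h₂ f₁ f₂ hi (ih (Set.subset_eq_empty h₁ hΓ))
  | allElim ht _ ih => exact .allElim ht (ih hΓ)
  | cd h _ ih => exact .cd h (ih hΓ)
  | exIntro ht h _ ih => exact .exIntro ht h (ih hΓ)
  | exElim h₁ h₂ f₁ f₂ hi hi' _ _ ih₁ ih₂ =>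
    exact .exElim h₁ h₂ f₁ f₂ hi hi' (ih₁ hΓ) (ih₂ (Set.subset_eq_empty h₁ hΓ))

/-- **Theorem 21**: `BQL_CD^r` and `BQL_CD` have the same theorems:
`⊢_{[-1]} φ` iff `⊢ φ`. -/
theorem same_theorems {L : Signature} (φ : Formula L.plus) (hφ : φ.Sentence) :
    PrvB L ∅ φ ↔ Prv L ∅ φ :=
  ⟨PrfN.toPrf, fun h => h.toPrfN rfl⟩

end BQL
end
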